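/- arXiv:2010.11287 — 3 statements merged into one kernel-verified Lean document; each statement's English description precedes it below -/
import Mathlib

section
/- Let T be a monoidal triangulated category in which every object is dualizable. Then (1) for every object A with dual A*, the thick ideal generated by A equals the thick ideal generated by A*, i.e. ⟨A⟩ = ⟨A*⟩; and (2) every thick two-sided ideal I of T is semiprime, i.e. I equals the intersection of all prime thick ideals containing I; equivalently, if A ⊗ C ⊗ A ∈ I for every object C of T, then A ∈ I. -/
open CategoryTheory Limits Pretriangulated MonoidalCategory ZeroObject

universe v u

namespace TTG

variable (C : Type u) [Category.{v} C] [HasZeroObject C] [Preadditive C]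
  [MonoidalCategory C] [HasShift C ℤ] [∀ n : ℤ, (shiftFunctor C n).Additive]
  [Pretriangulated C]

/-- A thick (two-sided, ⊗-)ideal of a monoidal triangulated category, encoded by its
class of objects. -/
structure ThickIdeal : Type (max u v) where
  mem : C → Prop
  iso_closed : ∀ {X Y : C}, (X ≅ Y) → mem X → mem Y
  zero_mem : mem 0
  shift_mem : ∀ (X : C) (n : ℤ), mem X → mem (X⟦n⟧)
  ext_mem : ∀ T : Triangle C, T ∈ (distTriang C) → mem T.obj₁ → mem T.obj₂ → mem T.obj₃
  retract_mem : ∀ {X Y : C} (i : X ⟶ Y) (r : Y ⟶ X), i ≫ r = 𝟙 X → mem Y → mem X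
  tensor_right_mem : ∀ X Y : C, mem X → mem (X ⊗ Y)
  tensor_left_mem : ∀ X Y : C, mem Y → mem (X ⊗ Y)

variable {C}

/-- A thick ideal `P` is prime if it is proper and `I ⊗ J ⊆ P` implies `I ⊆ P` or `J ⊆ P`
for all thick ideals `I`, `J`. -/
def ThickIdeal.IsPrime (P : ThickIdeal C) : Prop :=
  (∃ X : C, ¬ P.mem X) ∧
  ∀ I J : ThickIdeal C,
    (∀ X Y : C, I.mem X → J.mem Y → P.mem (X ⊗ Y)) →
    (∀ X : C, I.mem X → P.mem X) ∨ (∀ Y : C, J.mem Y → P.mem Y)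

variable (C)

/-- The Balmer spectrum: the collection of prime thick ideals. -/
def Spc : Type (max u v) := {P : ThickIdeal C // P.IsPrime}

/-- The Zariski topology on the Balmer spectrum, whose closed sets are generated by the
Balmer supports `V(A) = {P : A ∉ P}`. -/
instance : TopologicalSpace (Spc C) :=
  TopologicalSpace.generateFrom {U : Set (Spc C) | ∃ X : C, U = {P : Spc C | P.1.mem X}}

/-- The closed set `V(S) = {P ∈ Spc : S ∩ P = ∅}` associated to a collection of objects. -/
def V (S : Set C) : Set (Spc C) := {P : Spc C | ∀ X ∈ S, ¬ P.1.mem X}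

/-- The thick ideal generated by a collection of objects. -/
def genIdeal (S : Set C) : ThickIdeal C where
  mem X := ∀ J : ThickIdeal C, (∀ Y ∈ S, J.mem Y) → J.mem X
  iso_closed := fun e h J hJ => J.iso_closed e (h J hJ)
  zero_mem := fun J _ => J.zero_mem
  shift_mem := fun X n h J hJ => J.shift_mem X n (h J hJ)
  ext_mem := fun T hT h1 h2 J hJ => J.ext_mem T hT (h1 J hJ) (h2 J hJ)
  retract_mem := fun i r hir h J hJ => J.retract_mem i r hir (h J hJ)
  tensor_right_mem := fun X Y h J hJ => J.tensor_right_mem X Y (h J hJ)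
  tensor_left_mem := fun X Y h J hJ => J.tensor_left_mem X Y (h J hJ)

/-- (Object-level) exactness of the monoidal product: tensoring a distinguished triangle on
either side by any object again yields a distinguished triangle.  This is the compatibility
required of a monoidal triangulated category. -/
def TensorExact : Prop :=
  ∀ (X : C) (T : Triangle C), T ∈ (distTriang C) →
    (∃ T' ∈ (distTriang C), Nonempty (T'.obj₁ ≅ X ⊗ T.obj₁) ∧ Nonempty (T'.obj₂ ≅ X ⊗ T.obj₂) ∧
      Nonempty (T'.obj₃ ≅ X ⊗ T.obj₃)) ∧
    (∃ T' ∈ (distTriang C), Nonempty (T'.obj₁ ≅ T.obj₁ ⊗ X) ∧ Nonempty (T'.obj₂ ≅ T.obj₂ ⊗ X) ∧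
      Nonempty (T'.obj₃ ≅ T.obj₃ ⊗ X))

end TTG

namespace TTG

namespace ThickIdeal

variable {C : Type u} [Category.{v} C] [HasZeroObject C] [Preadditive C]
  [MonoidalCategory C] [HasShift C ℤ] [∀ n : ℤ, (shiftFunctor C n).Additive]
  [Pretriangulated C]

/-- Thick ideals are ordered by inclusion. -/
instance : Preorder (ThickIdeal C) := Preorder.lift ThickIdeal.mem

theorem mem_of_le {I J : ThickIdeal C} (h : I ≤ J) {X : C} (hX : I.mem X) : J.mem X :=
  h X hX

theorem mem_obj₁ (P : ThickIdeal C) {T : Triangle C} (hT : T ∈ distTriang C)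
    (h₂ : P.mem T.obj₂) (h₃ : P.mem T.obj₃) : P.mem T.obj₁ :=
  P.ext_mem _ (inv_rot_of_distTriang _ (inv_rot_of_distTriang _ hT))
    (P.shift_mem _ (-1) h₂) (P.shift_mem _ (-1) h₃)

/-- The object `A` is a retract of `A ⊗ Aᘁ ⊗ A`, so membership of the latter suffices. -/
theorem mem_of_mem_tensor_rightDual (P : ThickIdeal C) (A : C) [HasRightDual A]
    (h : P.mem (A ⊗ Aᘁ ⊗ A)) : P.mem A :=
  P.retract_mem ((λ_ A).inv ≫ η_ A Aᘁ ▷ A ≫ (α_ A Aᘁ A).hom) (A ◁ ε_ A Aᘁ ≫ (ρ_ A).hom)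
    (by simp) h

/-- The dual `Aᘁ` is a retract of `Aᘁ ⊗ A ⊗ Aᘁ`. -/
theorem rightDual_mem (P : ThickIdeal C) (A : C) [HasRightDual A] (h : P.mem A) :
    P.mem Aᘁ :=
  P.retract_mem ((ρ_ Aᘁ).inv ≫ Aᘁ ◁ η_ A Aᘁ) ((α_ Aᘁ A Aᘁ).inv ≫ ε_ A Aᘁ ▷ Aᘁ ≫ (λ_ Aᘁ).hom)
    (by simp) (P.tensor_left_mem _ _ (P.tensor_right_mem _ _ h))

theorem mem_of_rightDual_mem (P : ThickIdeal C) (A : C) [HasRightDual A] (h : P.mem Aᘁ) :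
    P.mem A :=
  P.mem_of_mem_tensor_rightDual A (P.tensor_left_mem _ _ (P.tensor_right_mem _ _ h))

/-- The union of a nonempty chain of thick ideals. -/
def chainUnion (c : Set (ThickIdeal C)) (hc : IsChain (· ≤ ·) c) (hne : c.Nonempty) :
    ThickIdeal C where
  mem X := ∃ I ∈ c, I.mem X
  iso_closed := fun e ⟨I, hI, h⟩ => ⟨I, hI, I.iso_closed e h⟩
  zero_mem := hne.imp fun I hI => ⟨hI, I.zero_mem⟩
  shift_mem := fun X n ⟨I, hI, h⟩ => ⟨I, hI, I.shift_mem X n h⟩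
  ext_mem := by
    rintro T hT ⟨I, hI, h₁⟩ ⟨J, hJ, h₂⟩
    obtain h | h := hc.total hI hJ
    · exact ⟨J, hJ, J.ext_mem T hT (mem_of_le h h₁) h₂⟩
    · exact ⟨I, hI, I.ext_mem T hT h₁ (mem_of_le h h₂)⟩
  retract_mem := fun i r hir ⟨I, hI, h⟩ => ⟨I, hI, I.retract_mem i r hir h⟩
  tensor_right_mem := fun X Y ⟨I, hI, h⟩ => ⟨I, hI, I.tensor_right_mem X Y h⟩
  tensor_left_mem := fun X Y ⟨I, hI, h⟩ => ⟨I, hI, I.tensor_left_mem X Y h⟩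

theorem exists_maximal_not_mem (I : ThickIdeal C) {A : C} (hA : ¬ I.mem A) :
    ∃ P : ThickIdeal C, I ≤ P ∧ Maximal (fun Q : ThickIdeal C => ¬ Q.mem A) P :=
  zorn_le_nonempty₀ {Q : ThickIdeal C | ¬ Q.mem A}
    (fun c hcs hc J hJ => ⟨chainUnion c hc ⟨J, hJ⟩, fun ⟨_, hK, h⟩ => hcs hK h,
      fun _ hK _ h => ⟨_, hK, h⟩⟩) I hA

theorem mem_tensor_obj₃ (htensor : TensorExact C) (P : ThickIdeal C) (Y : C)
    {T : Triangle C} (hT : T ∈ distTriang C) (h₁ : P.mem (T.obj₁ ⊗ Y))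
    (h₂ : P.mem (T.obj₂ ⊗ Y)) : P.mem (T.obj₃ ⊗ Y) := by
  obtain ⟨T', hT', ⟨e₁⟩, ⟨e₂⟩, ⟨e₃⟩⟩ := (htensor Y T hT).2
  exact P.iso_closed e₃ (P.ext_mem T' hT' (P.iso_closed e₁.symm h₁) (P.iso_closed e₂.symm h₂))

theorem mem_tensor_obj₁ (htensor : TensorExact C) (P : ThickIdeal C) (Y : C)
    {T : Triangle C} (hT : T ∈ distTriang C) (h₂ : P.mem (T.obj₂ ⊗ Y))
    (h₃ : P.mem (T.obj₃ ⊗ Y)) : P.mem (T.obj₁ ⊗ Y) := by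
  obtain ⟨T', hT', ⟨e₁⟩, ⟨e₂⟩, ⟨e₃⟩⟩ := (htensor Y T hT).2
  exact P.iso_closed e₁ (P.mem_obj₁ hT' (P.iso_closed e₂.symm h₂) (P.iso_closed e₃.symm h₃))

theorem mem_shift_tensor (htensor : TensorExact C) (P : ThickIdeal C) (X Y : C)
    (h : P.mem (X ⊗ Y)) (n : ℤ) : P.mem (X⟦n⟧ ⊗ Y) := by
  have h₀ : P.mem ((0 : C) ⊗ Y) := P.tensor_right_mem _ _ P.zero_mem
  induction n with
  | zero => exact P.iso_closed (whiskerRightIso ((shiftFunctorZero C ℤ).app X).symm Y) h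
  | succ n ih =>
    exact P.iso_closed
      (whiskerRightIso ((shiftFunctorAdd' C (n : ℤ) 1 (n + 1) rfl).app X).symm Y)
      (P.mem_tensor_obj₃ htensor Y (contractible_distinguished₂ (X⟦(n : ℤ)⟧)) ih h₀)
  | pred n ih =>
    exact P.mem_tensor_obj₁ htensor Y (contractible_distinguished₂ (X⟦(-n - 1 : ℤ)⟧)) h₀
      (P.iso_closed
        (whiskerRightIso ((shiftFunctorAdd' C (-n - 1 : ℤ) 1 (-n) (by lia)).app X) Y) ih)

/-- The right ideal quotient `P : K` of objects `X` with `X ⊗ Y ∈ P` for all `Y ∈ K`. -/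
def quotient (htensor : TensorExact C) (P K : ThickIdeal C) : ThickIdeal C where
  mem X := ∀ Y, K.mem Y → P.mem (X ⊗ Y)
  iso_closed := fun e h Y hY => P.iso_closed (whiskerRightIso e Y) (h Y hY)
  zero_mem := fun Y _ => P.tensor_right_mem _ _ P.zero_mem
  shift_mem := fun X n h Y hY => P.mem_shift_tensor htensor X Y (h Y hY) n
  ext_mem := fun _ hT h₁ h₂ Y hY => P.mem_tensor_obj₃ htensor Y hT (h₁ Y hY) (h₂ Y hY)
  retract_mem := fun i r hir h Y hY =>
    P.retract_mem (i ▷ Y) (r ▷ Y) (by rw [← comp_whiskerRight, hir, id_whiskerRight]) (h Y hY)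
  tensor_right_mem := fun X Z h Y hY =>
    P.iso_closed (α_ X Z Y).symm (h _ (K.tensor_left_mem Z Y hY))
  tensor_left_mem := fun Z X h Y hY =>
    P.iso_closed (α_ Z X Y).symm (P.tensor_left_mem _ _ (h Y hY))

theorem le_quotient (htensor : TensorExact C) (P K : ThickIdeal C) :
    P ≤ quotient htensor P K :=
  fun _ hX _ _ => P.tensor_right_mem _ _ hX

/-- In a rigid category, if `X` annihilates `K` on the left modulo `P`, then it also does so
on the right. -/
theorem tensor_mem_of_mem_quotient [RigidCategory C] (htensor : TensorExact C)
    {P K : ThickIdeal C} {X Y : C} (hX : (quotient htensor P K).mem X) (hY : K.mem Y) :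
    P.mem (Y ⊗ X) := by
  refine P.mem_of_mem_tensor_rightDual (Y ⊗ X) (P.iso_closed (α_ Y X _).symm ?_)
  exact P.tensor_left_mem _ _
    (hX _ (K.tensor_left_mem _ _ (K.tensor_right_mem _ _ hY)))

theorem isPrime_of_maximal_not_mem [RigidCategory C] (htensor : TensorExact C)
    {P : ThickIdeal C} {A : C} (hP : Maximal (fun Q : ThickIdeal C => ¬ Q.mem A) P) :
    P.IsPrime := by
  refine ⟨⟨A, hP.prop⟩, fun J K hJK => ?_⟩
  have mem_or_le (L : ThickIdeal C) (hL : P ≤ L) : L.mem A ∨ L ≤ P :=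
    or_iff_not_imp_left.2 fun h => hP.le_of_ge h hL
  let Q := quotient htensor P K
  obtain hQ | hQ := mem_or_le Q (le_quotient htensor P K)
  · obtain hR | hR := mem_or_le (quotient htensor P Q) (le_quotient htensor P Q)
    · exact absurd (P.mem_of_mem_tensor_rightDual A (hR _ (Q.tensor_left_mem _ _ hQ))) hP.prop
    · exact Or.inr fun Y hY =>
        hR Y fun X hX => tensor_mem_of_mem_quotient htensor hX hY
  · exact Or.inl fun X hX => hQ X fun Y hY => hJK X Y hX hY

end ThickIdeal

/-- NVY / Proposition `semiprime`.
Let `T` be a monoidal triangulated category in which every object is dualizable (i.e. `T` is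
rigid).  Then:
(1) for every object `A` with dual `Aᘁ`, the thick ideals generated by `A` and by `Aᘁ`
coincide: `⟨A⟩ = ⟨Aᘁ⟩`; and
(2) every thick two-sided ideal `I` of `T` is semiprime, i.e. `I` is the intersection of all
prime thick ideals containing it; equivalently, if `A ⊗ C ⊗ A ∈ I` for every object `C`,
then `A ∈ I`. -/
theorem balmer_spectra_drinfeld_centers_statement_0
    (T : Type u) [Category.{v} T] [HasZeroObject T] [Preadditive T]
    [MonoidalCategory T] [HasShift T ℤ] [∀ n : ℤ, (shiftFunctor T n).Additive]
    [Pretriangulated T]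
    -- compatibility of the monoidal and triangulated structures:
    (htensor : TensorExact T)
    -- every object of `T` is dualizable:
    [RigidCategory T] :
    (∀ A X : T, (genIdeal T {A}).mem X ↔ (genIdeal T {Aᘁ}).mem X) ∧
    (∀ I : ThickIdeal T,
      (∀ X : T, I.mem X ↔
        ∀ P : ThickIdeal T, P.IsPrime → (∀ Y : T, I.mem Y → P.mem Y) → P.mem X) ∧
      (∀ A : T, (∀ Z : T, I.mem (A ⊗ Z ⊗ A)) → I.mem A)) := by
  refine ⟨fun A X => ⟨fun h J hJ => h J ?_, fun h J hJ => h J ?_⟩, fun I => ⟨fun X =>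
    ⟨fun h P _ hI => hI X h, fun h => ?_⟩, fun A h => I.mem_of_mem_tensor_rightDual A (h _)⟩⟩
  · rintro _ rfl
    exact J.mem_of_rightDual_mem _ (hJ _ rfl)
  · rintro _ rfl
    exact J.rightDual_mem _ (hJ _ rfl)
  · by_contra hX
    obtain ⟨P, hIP, hP⟩ := I.exists_maximal_not_mem hX
    exact hP.prop (h P (ThickIdeal.isPrime_of_maximal_not_mem htensor hP) hIP)

end TTG
end

section
/- Let G be a finite group and k a field of characteristic p dividing the order of G. If P is a module over the Drinfeld double D(kG) whose restriction to the group algebra kG is projective, then P is projective as a D(kG)-module. (Key auxiliary claim: if 0 → A → B → C → 0 is a short exact sequence of D(kG)-modules that splits as a sequence of kG-modules, then it splits as a sequence of D(kG)-modules.) -/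
/-!
Statement 13 of "Balmer spectra and Drinfeld centers" (Vashaw), Lemma `group-projectives`.

A module over the Drinfeld double `D(kG)` of the group algebra `kG` of a finite group `G`
is the same thing as a `kG`-module `M` equipped with a `G`-grading `M = ⊕_{g ∈ G} M_g`
satisfying `h · M_g ⊆ M_{hgh⁻¹}`.  We encode the grading by the system of commuting
idempotent projections given by the action of the dual basis elements `p_g ∈ k[G] ⊆ D(kG)`.
-/

universe u

/-- A `kG`-module: a representation of `G` on a `k`-vector space. -/
structure GModule (k G : Type u) [Field k] [Group G] where
  M : Type u
  [acg : AddCommGroup M]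
  [mod : Module k M]
  ρ : Representation k G M

attribute [instance] GModule.acg GModule.mod

/-- A `D(kG)`-module: a `kG`-module together with a `G`-grading (encoded by the commuting
idempotent projections `π g`, the actions of the dual-basis idempotents `p_g`), such that
`h · M_g ⊆ M_{h g h⁻¹}`. -/
structure DModule (k G : Type u) [Field k] [Group G] [Fintype G] [DecidableEq G] where
  M : Type u
  [acg : AddCommGroup M]
  [mod : Module k M]
  ρ : Representation k G M
  π : G → (M →ₗ[k] M)
  π_orth : ∀ g h : G, (π g) ∘ₗ (π h) = if g = h then π g else 0
  π_total : (∑ g : G, π g) = LinearMap.id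
  compat : ∀ h g : G, (ρ h) ∘ₗ (π g) = (π (h * g * h⁻¹)) ∘ₗ (ρ h)

attribute [instance] DModule.acg DModule.mod

variable (k G : Type u) [Field k] [Group G]

/-- Morphisms of `kG`-modules. -/
structure GHom (A B : GModule k G) where
  f : A.M →ₗ[k] B.M
  comm_ρ : ∀ g : G, f ∘ₗ A.ρ g = B.ρ g ∘ₗ f

variable [Fintype G] [DecidableEq G]

/-- Morphisms of `D(kG)`-modules. -/
structure DHom (A B : DModule k G) where
  f : A.M →ₗ[k] B.M
  comm_ρ : ∀ g : G, f ∘ₗ A.ρ g = B.ρ g ∘ₗ f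
  comm_π : ∀ g : G, f ∘ₗ A.π g = B.π g ∘ₗ f

/-- The restriction (forgetful) functor `F` from `D(kG)`-modules to `kG`-modules. -/
def DModule.restrict (A : DModule k G) : GModule k G :=
  { M := A.M, ρ := A.ρ }

/-- Projectivity of a `kG`-module, via the lifting property in the category of
`kG`-modules. -/
def GProjective (P : GModule k G) : Prop :=
  ∀ (B C : GModule k G) (t : GHom k G B C) (u : GHom k G P C),
    Function.Surjective t.f → ∃ v : GHom k G P B, ∀ x : P.M, t.f (v.f x) = u.f x

/-- Projectivity of a `D(kG)`-module, via the lifting property in the category of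
`D(kG)`-modules. -/
def DProjective (P : DModule k G) : Prop :=
  ∀ (B C : DModule k G) (t : DHom k G B C) (u : DHom k G P C),
    Function.Surjective t.f → ∃ v : DHom k G P B, ∀ x : P.M, t.f (v.f x) = u.f x

/-- The degree-preserving part `∑ g, π_g ∘ f ∘ π_g` of a `kG`-linear map between
`D(kG)`-modules is `D(kG)`-linear. -/
def DHom.degreePreservingPart {k G : Type u} [Field k] [Group G] [Fintype G] [DecidableEq G]
    {A B : DModule k G} (f : A.M →ₗ[k] B.M) (hf : ∀ g : G, f ∘ₗ A.ρ g = B.ρ g ∘ₗ f) :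
    DHom k G A B where
  f := ∑ g : G, B.π g ∘ₗ f ∘ₗ A.π g
  comm_ρ h := by
    have hf (x : A.M) : f (A.ρ h x) = B.ρ h (f x) := LinearMap.congr_fun (hf h) x
    have hA (g : G) (x : A.M) : A.ρ h (A.π g x) = A.π (h * g * h⁻¹) (A.ρ h x) :=
      LinearMap.congr_fun (A.compat h g) x
    have hB (g : G) (x : B.M) : B.ρ h (B.π g x) = B.π (h * g * h⁻¹) (B.ρ h x) :=
      LinearMap.congr_fun (B.compat h g) x
    ext x
    simp only [LinearMap.comp_apply, LinearMap.sum_apply, map_sum, hB, ← hf, hA]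
    exact (Equiv.sum_comp (MulAut.conj h).toEquiv fun g =>
      B.π g (f (A.π g (A.ρ h x)))).symm
  comm_π h := by
    have hA (g : G) (x : A.M) : A.π g (A.π h x) = if g = h then A.π g x else 0 := by
      simpa [apply_ite (fun φ : A.M →ₗ[k] A.M => φ x)] using
        LinearMap.congr_fun (A.π_orth g h) x
    have hB (g : G) (x : B.M) : B.π h (B.π g x) = if h = g then B.π h x else 0 := by
      simpa [apply_ite (fun φ : B.M →ₗ[k] B.M => φ x)] using
        LinearMap.congr_fun (B.π_orth h g) x
    ext x
    simp [hA, hB, apply_ite]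

/-- If `f` is a `kG`-linear lift of a `D(kG)`-linear map `u` along a `D(kG)`-linear map `t`,
then so is its degree-preserving part. -/
theorem DHom.degreePreservingPart_lift {k G : Type u} [Field k] [Group G] [Fintype G]
    [DecidableEq G] {P B C : DModule k G} (t : DHom k G B C) (u : DHom k G P C)
    (f : P.M →ₗ[k] B.M) (hf : ∀ g : G, f ∘ₗ P.ρ g = B.ρ g ∘ₗ f)
    (h : ∀ x : P.M, t.f (f x) = u.f x) (x : P.M) :
    t.f ((degreePreservingPart f hf).f x) = u.f x := by
  have ht (g : G) (y : B.M) : t.f (B.π g y) = C.π g (t.f y) :=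
    LinearMap.congr_fun (t.comm_π g) y
  have hu (g : G) (y : P.M) : u.f (P.π g y) = C.π g (u.f y) :=
    LinearMap.congr_fun (u.comm_π g) y
  have hπ (g : G) (y : C.M) : C.π g (C.π g y) = C.π g y := by
    simpa using LinearMap.congr_fun (C.π_orth g g) y
  calc t.f ((degreePreservingPart f hf).f x)
      = ∑ g : G, C.π g (t.f (f (P.π g x))) := by
        simp only [degreePreservingPart, LinearMap.sum_apply, LinearMap.comp_apply, map_sum, ht]
    _ = ∑ g : G, C.π g (u.f x) := by simp only [h, hu, hπ]
    _ = u.f x := by rw [← LinearMap.sum_apply, C.π_total, LinearMap.id_apply]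

/-- Lemma `group-projectives`.
Let `G` be a finite group and `k` a field of characteristic `p` dividing the order of `G`.
If `P` is a module over the Drinfeld double `D(kG)` whose restriction to the group algebra
`kG` is projective, then `P` is projective as a `D(kG)`-module.
(Key auxiliary claim: if `0 → A → B → C → 0` is a short exact sequence of `D(kG)`-modules
that splits as a sequence of `kG`-modules, then it splits as a sequence of
`D(kG)`-modules.) -/
theorem balmer_spectra_drinfeld_centers_statement_13
    (p : ℕ) [Fact p.Prime] [CharP k p] (hdvd : p ∣ Fintype.card G) :
    -- auxiliary claim:
    (∀ (A B C : DModule k G) (i : DHom k G A B) (t : DHom k G B C),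
      Function.Injective i.f → Function.Surjective t.f →
      (∀ x : B.M, t.f x = 0 ↔ x ∈ Set.range i.f) →
      (∃ s : GHom k G (C.restrict) (B.restrict), ∀ x : C.M, t.f (s.f x) = x) →
      ∃ s : DHom k G C B, ∀ x : C.M, t.f (s.f x) = x) ∧
    -- main claim:
    (∀ P : DModule k G, GProjective k G (P.restrict) → DProjective k G P) := by
  refine ⟨fun A B C _ t _ _ _ ⟨s, hs⟩ => ?_, fun P hP B C t u ht => ?_⟩
  · exact ⟨DHom.degreePreservingPart s.f s.comm_ρ, DHom.degreePreservingPart_lift t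
      ⟨LinearMap.id, fun _ => rfl, fun _ => rfl⟩ s.f s.comm_ρ hs⟩
  · obtain ⟨v, hv⟩ := hP B.restrict C.restrict ⟨t.f, t.comm_ρ⟩ ⟨u.f, u.comm_ρ⟩ ht
    exact ⟨DHom.degreePreservingPart v.f v.comm_ρ,
      DHom.degreePreservingPart_lift t u v.f v.comm_ρ hv⟩
end

section
/- Let H be a finite-dimensional Hopf algebra such that the trivial D(H)-module 1_{D(H)} is a direct summand of D(H) ⊗_H 1_H as D(H)-modules. Then a D(H)-module P is projective if and only if its restriction F(P) to H is projective. -/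
/-!
Statement 15 of "Balmer spectra and Drinfeld centers" (Vashaw), Lemma `unit-summand-proj`.
-/

universe u

/-- An inclusion of Hopf algebras `ι : H → D`, modelling the inclusion of a
finite-dimensional Hopf algebra `H` into its Drinfeld double `D = D(H)`:
an injective algebra map which is also a coalgebra map. -/
structure HopfInclusion (k H D : Type u) [Field k] [Ring H] [HopfAlgebra k H]
    [Ring D] [HopfAlgebra k D] where
  ι : H →ₐ[k] D
  inj : Function.Injective ι
  compat_counit : ∀ h : H, Coalgebra.counit (R := k) (ι h) = Coalgebra.counit (R := k) h
  compat_comul : ∀ h : H, Coalgebra.comul (R := k) (ι h) =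
    TensorProduct.map ι.toLinearMap ι.toLinearMap (Coalgebra.comul (R := k) h)

section

open TensorProduct Coalgebra HopfAlgebra

section Averaging

variable {k H V W : Type u} [Field k] [Ring H] [HopfAlgebra k H]
  [AddCommGroup V] [Module k V] [AddCommGroup W] [Module k W]

lemma sum_trilinear_comul_eq (T : H →ₗ[k] H →ₗ[k] H →ₗ[k] V) (a : H) :
    ∑ i ∈ (ℛ k a).index, ∑ j ∈ (ℛ k ((ℛ k a).left i)).index,
      T ((ℛ k ((ℛ k a).left i)).left j) ((ℛ k ((ℛ k a).left i)).right j) ((ℛ k a).right i) =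
    ∑ i ∈ (ℛ k a).index, ∑ j ∈ (ℛ k ((ℛ k a).right i)).index,
      T ((ℛ k a).left i) ((ℛ k ((ℛ k a).right i)).left j) ((ℛ k ((ℛ k a).right i)).right j) := by
  have := congrArg (TensorProduct.lift ((TensorProduct.uncurry (.id k) H H V) ∘ₗ T))
    (sum_tmul_tmul_eq (ℛ k a) (fun i => ℛ k ((ℛ k a).left i)) (fun i => ℛ k ((ℛ k a).right i)))
  simpa using this

/-- `x ↦ ∑ σ(x₁) ∘ g ∘ ρ(S(x₂))`. -/
noncomputable def hopfAverage (ρ : H →ₐ[k] Module.End k V) (σ : H →ₐ[k] Module.End k W)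
    (g : V →ₗ[k] W) : H →ₗ[k] V →ₗ[k] W :=
  TensorProduct.lift (LinearMap.mk₂ k (fun x y => σ x ∘ₗ g ∘ₗ ρ (antipode k y))
    (by intros; ext; simp) (by intros; ext; simp) (by intros; ext; simp) (by intros; ext; simp))
    ∘ₗ comul

variable (ρ : H →ₐ[k] Module.End k V) (σ : H →ₐ[k] Module.End k W) (g : V →ₗ[k] W)

lemma hopfAverage_eq_sum {ι : Type*} {x : H} (r : Coalgebra.Repr k x ι) :
    hopfAverage ρ σ g x = ∑ i ∈ r.index, σ (r.left i) ∘ₗ g ∘ₗ ρ (antipode k (r.right i)) := by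
  simp [hopfAverage, ← r.eq]

lemma hopfAverage_mul (z x : H) :
    hopfAverage ρ σ g (z * x) = hopfAverage ρ σ (hopfAverage ρ σ g x) z := by
  rw [hopfAverage_eq_sum ρ σ g ((ℛ k z).mul (ℛ k x)), hopfAverage_eq_sum ρ σ _ (ℛ k z),
    hopfAverage_eq_sum ρ σ g (ℛ k x)]
  ext v
  simp [Finset.sum_product, antipode_mul_antidistrib]

lemma hopfAverage_intertwines {x : H}
    (hx : ∀ z, hopfAverage ρ σ g (z * x) = counit (R := k) z • hopfAverage ρ σ g x)
    (z : H) (v : V) :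
    hopfAverage ρ σ g x (ρ z v) = σ z (hopfAverage ρ σ g x v) := by
  set G := hopfAverage ρ σ g x with hG
  simp_rw [hopfAverage_mul, ← hG] at hx
  let T : H →ₗ[k] H →ₗ[k] H →ₗ[k] W :=
    LinearMap.mk₂ k (fun a b => σ a ∘ₗ G ∘ₗ ρ (antipode k b) ∘ₗ ρ.toLinearMap.flip v)
      (by intros; ext; simp) (by intros; ext; simp) (by intros; ext; simp) (by intros; ext; simp)
  have key := sum_trilinear_comul_eq T z
  have h1 : ∀ i, ∑ j ∈ (ℛ k ((ℛ k z).left i)).index,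
      T ((ℛ k ((ℛ k z).left i)).left j) ((ℛ k ((ℛ k z).left i)).right j) ((ℛ k z).right i) =
      G (ρ (counit (R := k) ((ℛ k z).left i) • (ℛ k z).right i) v) := by
    intro i
    have := congrArg (fun f : V →ₗ[k] W => f (ρ ((ℛ k z).right i) v)) (hx ((ℛ k z).left i))
    rw [hopfAverage_eq_sum ρ σ G (ℛ k ((ℛ k z).left i))] at this
    simpa [T] using this
  have h2 : ∀ i, ∑ j ∈ (ℛ k ((ℛ k z).right i)).index,
      T ((ℛ k z).left i) ((ℛ k ((ℛ k z).right i)).left j) ((ℛ k ((ℛ k z).right i)).right j) =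
      σ (counit (R := k) ((ℛ k z).right i) • (ℛ k z).left i) (G v) := by
    intro i
    have := congrArg (fun y => σ ((ℛ k z).left i) (G (ρ y v)))
      (sum_antipode_mul_eq_smul (ℛ k ((ℛ k z).right i)))
    simpa [T] using this
  rw [Finset.sum_congr rfl fun i _ => h1 i, Finset.sum_congr rfl fun i _ => h2 i] at key
  have h3 := congrArg (TensorProduct.rid k H) (sum_tmul_counit_eq (R := k) (ℛ k z))
  simp only [map_sum, TensorProduct.rid_tmul, one_smul] at h3
  have h4 := sum_counit_smul (R := k) (ℛ k z)
  calc G (ρ z v) = _ := by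
        conv_lhs => rw [← h4]
        simp only [map_sum, LinearMap.sum_apply]
    _ = _ := key
    _ = σ z (G v) := by
        conv_rhs => rw [← h3]
        simp only [map_sum, LinearMap.sum_apply]

end Averaging
section Integral

variable {k H : Type u} [Field k] [Ring H] [HopfAlgebra k H]

/-- `x ↦ ∑ q(x₁) S²(x₂) y`, whose trace is the value of `q` at a left integral. -/
noncomputable def integralOp (y : H) (q : Module.Dual k H) : H →ₗ[k] H :=
  TensorProduct.lift (LinearMap.mk₂ k (fun a b => q a • (antipode k (antipode k b) * y))
    (by intros; simp [add_smul]) (by intros; simp [mul_smul]) (by intros; simp [add_mul])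
    (by intros; simp [smul_smul, mul_comm])) ∘ₗ comul

lemma integralOp_eq_sum (y : H) (q : Module.Dual k H) {ι : Type*} {x : H}
    (r : Coalgebra.Repr k x ι) :
    integralOp y q x =
      ∑ i ∈ r.index, q (r.left i) • (antipode k (antipode k (r.right i)) * y) := by
  simp [integralOp, ← r.eq]

lemma sum_antipode_mul_antipode_antipode {ι : Type*} {x : H} (r : Coalgebra.Repr k x ι) :
    ∑ i ∈ r.index, antipode k (r.right i) * antipode k (antipode k (r.left i)) =
      counit (R := k) x • 1 := by
  have := congrArg (antipode k) (sum_antipode_mul_eq_smul (R := k) r)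
  simpa [antipode_mul_antidistrib, antipode_one] using this

lemma sum_antipode_antipode_mul_antipode {ι : Type*} {x : H} (r : Coalgebra.Repr k x ι) :
    ∑ i ∈ r.index, antipode k (antipode k (r.right i)) * antipode k (r.left i) =
      counit (R := k) x • 1 := by
  have := congrArg (antipode k) (sum_mul_antipode_eq_smul (R := k) r)
  simpa [antipode_mul_antidistrib, antipode_one] using this

lemma sum_smul_counit {V : Type u} [AddCommGroup V] [Module k V] (f : H →ₗ[k] V) (h : H) :
    ∑ i ∈ (ℛ k h).index, counit (R := k) ((ℛ k h).right i) • f ((ℛ k h).left i) = f h := by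
  have h3 := congrArg (f ∘ₗ (TensorProduct.rid k H).toLinearMap)
    (sum_tmul_counit_eq (R := k) (ℛ k h))
  simp only [map_sum, LinearMap.comp_apply, LinearEquiv.coe_coe, TensorProduct.rid_tmul,
    map_smul, one_smul] at h3
  exact h3

lemma integralOp_comp_mulLeft (y : H) (q : Module.Dual k H) (h : H) :
    integralOp y (q ∘ₗ LinearMap.mulLeft k h) =
      ∑ i ∈ (ℛ k h).index, LinearMap.mulLeft k (antipode k ((ℛ k h).right i)) *
        (integralOp y q * LinearMap.mulLeft k ((ℛ k h).left i)) := by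
  ext x
  let T : H →ₗ[k] H →ₗ[k] H →ₗ[k] H :=
    LinearMap.mk₂ k (fun a b => LinearMap.mulRight k (∑ j ∈ (ℛ k x).index,
        q (a * (ℛ k x).left j) •
          (antipode k (antipode k (b * (ℛ k x).right j)) * y)) ∘ₗ antipode k)
      (by intros; ext; simp [add_mul, add_smul, Finset.sum_add_distrib, mul_add])
      (by intros; ext; simp [mul_smul, ← Finset.smul_sum])
      (by intros; ext; simp [add_mul, Finset.sum_add_distrib, mul_add])
      (by intro c a b; ext; simp [smul_comm _ c, ← Finset.smul_sum])
  have key := sum_trilinear_comul_eq T h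
  have h1 : ∀ i, ∑ j ∈ (ℛ k ((ℛ k h).left i)).index,
      T ((ℛ k ((ℛ k h).left i)).left j) ((ℛ k ((ℛ k h).left i)).right j) ((ℛ k h).right i) =
      antipode k ((ℛ k h).right i) * integralOp y q ((ℛ k h).left i * x) := by
    intro i
    rw [integralOp_eq_sum y q ((ℛ k ((ℛ k h).left i)).mul (ℛ k x))]
    simp [T, Finset.sum_product, Finset.mul_sum]
  have h2 : ∀ i, ∑ j ∈ (ℛ k ((ℛ k h).right i)).index,
      T ((ℛ k h).left i) ((ℛ k ((ℛ k h).right i)).left j) ((ℛ k ((ℛ k h).right i)).right j) =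
      counit (R := k) ((ℛ k h).right i) •
        integralOp y (q ∘ₗ LinearMap.mulLeft k ((ℛ k h).left i)) x := by
    intro i
    rw [integralOp_eq_sum y _ (ℛ k x)]
    simp only [T, LinearMap.mk₂_apply, LinearMap.comp_apply, LinearMap.mulRight_apply,
      Finset.mul_sum, Finset.smul_sum, antipode_mul_antidistrib, mul_smul_comm,
      LinearMap.mulLeft_apply]
    rw [Finset.sum_comm]
    refine Finset.sum_congr rfl fun j _ => ?_
    rw [← Finset.smul_sum, smul_comm]
    congr 1
    simp_rw [← mul_assoc, ← Finset.sum_mul]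
    rw [sum_antipode_mul_antipode_antipode]
    simp
  rw [Finset.sum_congr rfl fun i _ => h1 i, Finset.sum_congr rfl fun i _ => h2 i] at key
  have lin : ∃ L : H →ₗ[k] H, ∀ a, L a = integralOp y (q ∘ₗ LinearMap.mulLeft k a) x := by
    refine ⟨∑ j ∈ (ℛ k x).index, (q ∘ₗ LinearMap.mulRight k ((ℛ k x).left j)).smulRight
      (antipode k (antipode k ((ℛ k x).right j)) * y), fun a => ?_⟩
    rw [integralOp_eq_sum y _ (ℛ k x)]
    simp
  obtain ⟨L, hL⟩ := lin
  simp_rw [← hL, sum_smul_counit L h, hL] at key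
  simp only [LinearMap.sum_apply, Module.End.mul_apply, LinearMap.mulLeft_apply]
  exact key.symm

variable [FiniteDimensional k H]

variable (k) in
/-- The element of `H` representing the functional `q ↦ tr (integralOp y q)`. -/
noncomputable def leftIntegral : H →ₗ[k] H where
  toFun y := (Module.evalEquiv k H).symm
    { toFun := fun q => LinearMap.trace k H (integralOp y q)
      map_add' := fun p q => by
        rw [← map_add]; congr 1; ext x; simp [integralOp_eq_sum _ _ (ℛ k x), add_smul,
          Finset.sum_add_distrib]
      map_smul' := fun c q => by
        rw [RingHom.id_apply, ← map_smul]; congr 1; ext x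
        simp [integralOp_eq_sum _ _ (ℛ k x), mul_smul, Finset.smul_sum] }
  map_add' y z := by
    rw [← map_add]; congr 1; ext q
    simp only [LinearMap.coe_mk, AddHom.coe_mk, LinearMap.add_apply]
    rw [← map_add]; congr 1; ext x
    simp [integralOp_eq_sum _ _ (ℛ k x), mul_add, Finset.sum_add_distrib]
  map_smul' c y := by
    rw [← map_smul]; congr 1; ext q
    simp only [LinearMap.coe_mk, AddHom.coe_mk, LinearMap.smul_apply, RingHom.id_apply]
    rw [← map_smul]; congr 1; ext x
    simp [integralOp_eq_sum _ _ (ℛ k x), Finset.smul_sum, smul_comm c]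

lemma apply_leftIntegral (q : Module.Dual k H) (y : H) :
    q (leftIntegral k y) = LinearMap.trace k H (integralOp y q) := by
  simp [leftIntegral]

lemma mul_leftIntegral (h y : H) :
    h * leftIntegral k y = counit (R := k) h • leftIntegral k y := by
  refine (Module.evalEquiv k H).injective (LinearMap.ext fun q => ?_)
  have : q (h * leftIntegral k y) = (q ∘ₗ LinearMap.mulLeft k h) (leftIntegral k y) := rfl
  simp only [Module.evalEquiv_apply, map_smul, LinearMap.smul_apply, Module.Dual.eval_apply]
  rw [this, apply_leftIntegral, apply_leftIntegral, integralOp_comp_mulLeft, map_sum]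
  simp_rw [LinearMap.trace_mul_comm k (LinearMap.mulLeft k (antipode k _)), mul_assoc]
  rw [← map_sum, ← Finset.mul_sum]
  have : ∑ i ∈ (ℛ k h).index, LinearMap.mulLeft k ((ℛ k h).left i) *
      LinearMap.mulLeft k (antipode k ((ℛ k h).right i)) = counit (R := k) h • 1 := by
    ext x
    have := congrArg (· * x) (sum_mul_antipode_eq_smul (R := k) (ℛ k h))
    simpa [Finset.sum_mul, mul_assoc] using this
  rw [this]
  simp

variable (k H) in
lemma trace_antipode_leftIntegral :
    LinearMap.trace k H (antipode k ∘ₗ leftIntegral k) = 1 := by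
  let b := Module.finBasis k H
  have h1 : ∑ j, integralOp (b j) (b.coord j ∘ₗ antipode k) =
      (counit (R := k) (A := H)).smulRight (1 : H) := by
    ext x
    simp only [LinearMap.sum_apply, integralOp_eq_sum _ _ (ℛ k x)]
    rw [Finset.sum_comm]
    simp_rw [← mul_smul_comm, ← Finset.mul_sum, LinearMap.comp_apply, Module.Basis.coord_apply,
      b.sum_repr]
    rw [sum_antipode_antipode_mul_antipode]
    simp
  have h2 := congrArg (LinearMap.trace k H) h1
  rw [LinearMap.trace_smulRight, Bialgebra.counit_one, map_sum] at h2
  simp_rw [← apply_leftIntegral] at h2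
  rw [LinearMap.trace_eq_matrix_trace k b, Matrix.trace, ← h2]
  simp [LinearMap.toMatrix_apply]

variable (k H) in
/-- A finite-dimensional Hopf algebra has a nonzero left integral. -/
theorem exists_leftIntegral :
    ∃ Λ : H, Λ ≠ 0 ∧ ∀ h, h * Λ = counit (R := k) h • Λ := by
  by_contra! hc
  have h0 : leftIntegral k (H := H) = 0 := by
    ext y
    by_contra hy
    obtain ⟨h, hh⟩ := hc _ hy
    exact hh (mul_leftIntegral h y)
  have := trace_antipode_leftIntegral k (H := H)
  simp [h0] at this

end Integral

section Antipode

variable {k H : Type u} [Field k] [Ring H] [HopfAlgebra k H] [FiniteDimensional k H]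

variable (k H) in
/-- The antipode of a finite-dimensional Hopf algebra is bijective. -/
theorem antipode_bijective : Function.Bijective (antipode k : H →ₗ[k] H) := by
  suffices hs : Function.Surjective (antipode k : H →ₗ[k] H) from
    ⟨LinearMap.injective_iff_surjective.2 hs, hs⟩
  rw [← LinearMap.dualMap_injective_iff, injective_iff_map_eq_zero]
  intro g hg
  have hg' : ∀ x, g (antipode k x) = 0 := fun x => LinearMap.congr_fun hg x
  obtain ⟨Λ, hΛ, hint⟩ := exists_leftIntegral k H
  let ρ : H →ₐ[k] Module.End k H := Algebra.lmul k H
  have hav := hopfAverage_intertwines ρ ρ (g.smulRight (1 : H)) (x := Λ)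
    (fun z => by rw [hint, map_smul])
  let b := Module.finBasis k H
  obtain ⟨c, hc⟩ := TensorProduct.eq_repr_basis_left b (comul (R := k) Λ)
  let r : Coalgebra.Repr k Λ (Fin (Module.finrank k H)) :=
    ⟨Finset.univ, b, c, by rw [← hc, Finsupp.sum_fintype _ _ (by simp)]⟩
  have hz : ∀ z i, g (antipode k (c i) * z) = 0 := by
    intro z
    have h1 := hav z 1
    rw [hopfAverage_eq_sum _ _ _ r] at h1
    simp [ρ, hg', r] at h1
    exact fun i => (Fintype.linearIndependent_iff.1 b.linearIndependent) _ h1 i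
  ext z
  let T : H →ₗ[k] H →ₗ[k] H →ₗ[k] H :=
    LinearMap.mk₂ k (fun a d => ((g ∘ₗ LinearMap.mulRight k (antipode k (antipode k d) * z)) ∘ₗ
        antipode k).smulRight a)
      (by intros; ext; simp) (by intro c _ _; ext; simp [smul_comm _ c])
      (by intros; ext; simp [mul_add, add_mul, add_smul, mul_assoc])
      (by intros; ext; simp [mul_smul, mul_assoc])
  have key := congrArg (TensorProduct.lift ((TensorProduct.uncurry (.id k) H H H) ∘ₗ T))
    (sum_tmul_tmul_eq r (fun i => ℛ k (r.left i)) (fun i => ℛ k (r.right i)))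
  have h2 : ∀ i, ∑ j ∈ (ℛ k (r.right i)).index, g (antipode k ((ℛ k (r.right i)).right j) *
      (antipode k (antipode k ((ℛ k (r.right i)).left j)) * z)) =
      counit (R := k) (r.right i) * g z := by
    intro i
    have := congrArg (fun y => g (y * z)) (sum_antipode_mul_antipode_antipode (ℛ k (r.right i)))
    simpa [Finset.sum_mul, mul_assoc] using this
  simp only [map_sum, TensorProduct.lift.tmul, LinearMap.comp_apply,
    TensorProduct.uncurry_apply, T, LinearMap.mk₂_apply, LinearMap.smulRight_apply,
    LinearMap.mulRight_apply, ← Finset.sum_smul, h2] at key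
  have h3 := congrArg (TensorProduct.rid k H) (sum_tmul_counit_eq (R := k) r)
  simp only [map_sum, TensorProduct.rid_tmul, one_smul] at h3
  simp_rw [mul_comm _ (g z), mul_smul, ← Finset.smul_sum, h3] at key
  have h0 : g z • Λ = 0 := by
    rw [← key]
    exact Finset.sum_eq_zero fun i _ => Finset.sum_eq_zero fun j _ => by
      rw [show r.right i = c i from rfl, hz, zero_smul]
  simpa [hΛ] using h0

variable (k H) in
lemma exists_antipode_isRightIntegral :
    ∃ Λ : H, (∀ h, h * Λ = counit (R := k) h • Λ) ∧ antipode k Λ ≠ 0 ∧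
      ∀ h, antipode k Λ * h = counit (R := k) h • antipode k Λ := by
  obtain ⟨Λ, hΛ, hint⟩ := exists_leftIntegral k H
  refine ⟨Λ, hint, fun h => hΛ ((antipode_bijective k H).1 (by rw [h, map_zero])), fun h => ?_⟩
  obtain ⟨h, rfl⟩ := (antipode_bijective k H).2 h
  rw [← antipode_mul_antidistrib, hint, map_smul, counit_antipode]

end Antipode

section Representations

variable {k H V W V' W' U : Type u} [Field k] [Ring H] [HopfAlgebra k H]
  [AddCommGroup V] [Module k V] [AddCommGroup W] [Module k W]
  [AddCommGroup V'] [Module k V'] [AddCommGroup W'] [Module k W'] [AddCommGroup U] [Module k U]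

/-- The tensor product of two representations, with the diagonal action. -/
noncomputable def tensorRep (ρ : H →ₐ[k] Module.End k V) (σ : H →ₐ[k] Module.End k W) :
    H →ₐ[k] Module.End k (V ⊗[k] W) :=
  (Module.endTensorEndAlgHom (R := k) (S := k) (A := k)).comp
    ((Algebra.TensorProduct.map ρ σ).comp (Bialgebra.comulAlgHom k H))

/-- The representation on `V ⊗ W` in which only the first factor is acted upon. -/
noncomputable def ampRep (ρ : H →ₐ[k] Module.End k V) (W : Type u) [AddCommGroup W] [Module k W] :
    H →ₐ[k] Module.End k (V ⊗[k] W) :=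
  (Module.endTensorEndAlgHom (R := k) (S := k) (A := k)).comp
    ((Algebra.TensorProduct.includeLeft (R := k) (S := k) (B := Module.End k W)).comp ρ)

lemma tensorRep_tmul (ρ : H →ₐ[k] Module.End k V) (σ : H →ₐ[k] Module.End k W) {ι : Type*} {h : H}
    (r : Coalgebra.Repr k h ι) (v : V) (w : W) :
    tensorRep ρ σ h (v ⊗ₜ w) = ∑ i ∈ r.index, ρ (r.left i) v ⊗ₜ σ (r.right i) w := by
  simp [tensorRep, ← r.eq]
  rfl

lemma ampRep_apply (ρ : H →ₐ[k] Module.End k V) (h : H) :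
    ampRep ρ W h = (ρ h).rTensor W := rfl

/-- `f` is a morphism of representations. -/
def Intertwines (ρ : H →ₐ[k] Module.End k V) (σ : H →ₐ[k] Module.End k W) (f : V →ₗ[k] W) : Prop :=
  ∀ h v, f (ρ h v) = σ h (f v)

lemma Intertwines.of_tmul {ρ : H →ₐ[k] Module.End k (V ⊗[k] W)} {σ : H →ₐ[k] Module.End k U}
    {f : V ⊗[k] W →ₗ[k] U} (hf : ∀ h v w, f (ρ h (v ⊗ₜ w)) = σ h (f (v ⊗ₜ w))) :
    Intertwines ρ σ f := by
  intro h x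
  induction x with
  | zero => simp
  | tmul v w => exact hf h v w
  | add x y hx hy => simp [hx, hy]

lemma Intertwines.map {ρ : H →ₐ[k] Module.End k V} {σ : H →ₐ[k] Module.End k W}
    {ρ' : H →ₐ[k] Module.End k V'} {σ' : H →ₐ[k] Module.End k W'} {f : V →ₗ[k] V'}
    {g : W →ₗ[k] W'} (hf : Intertwines ρ ρ' f) (hg : Intertwines σ σ' g) :
    Intertwines (tensorRep ρ σ) (tensorRep ρ' σ') (TensorProduct.map f g) :=
  .of_tmul fun h v w => by
    simp [tensorRep_tmul _ _ (ℛ k h), hf (_ : H), hg (_ : H)]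

lemma Intertwines.symm {ρ : H →ₐ[k] Module.End k V} {σ : H →ₐ[k] Module.End k W}
    {e : V ≃ₗ[k] W} (he : Intertwines ρ σ e.toLinearMap) :
    Intertwines σ ρ e.symm.toLinearMap := fun h w =>
  e.injective (by simpa using (he h (e.symm w)).symm)

lemma intertwines_id (ρ : H →ₐ[k] Module.End k V) : Intertwines ρ ρ .id := fun _ _ => rfl

lemma intertwines_assoc (ρ : H →ₐ[k] Module.End k V) (σ : H →ₐ[k] Module.End k W)
    (τ : H →ₐ[k] Module.End k U) :
    Intertwines (tensorRep (tensorRep ρ σ) τ) (tensorRep ρ (tensorRep σ τ))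
      (TensorProduct.assoc k V W U).toLinearMap := by
  refine .of_tmul fun h x u => ?_
  induction x with
  | zero => simp
  | add x y hx hy => simp only [TensorProduct.add_tmul, map_add, hx, hy]
  | tmul v w =>
    let T : H →ₗ[k] H →ₗ[k] H →ₗ[k] V ⊗[k] (W ⊗[k] U) :=
      LinearMap.mk₂ k (fun a b => TensorProduct.mk k V (W ⊗[k] U) (ρ a v) ∘ₗ
          TensorProduct.mk k W U (σ b w) ∘ₗ τ.toLinearMap.flip u)
        (by intros; ext; simp)
        (by intros; ext; simp [TensorProduct.smul_tmul'])
        (by intros; ext; simp [TensorProduct.tmul_add])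
        (by intros; ext; simp)
    have key := sum_trilinear_comul_eq T h
    rw [tensorRep_tmul _ _ (ℛ k h)]
    simp_rw [tensorRep_tmul ρ σ (ℛ k ((ℛ k h).left _))]
    simp only [TensorProduct.sum_tmul, map_sum, LinearEquiv.coe_coe, TensorProduct.assoc_tmul]
    rw [tensorRep_tmul _ _ (ℛ k h)]
    simp_rw [tensorRep_tmul σ τ (ℛ k ((ℛ k h).right _)), TensorProduct.tmul_sum]
    exact key

lemma intertwines_assoc_ampRep (ρ : H →ₐ[k] Module.End k V) (σ : H →ₐ[k] Module.End k W) :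
    Intertwines (ampRep (tensorRep ρ σ) U) (tensorRep ρ (ampRep σ U))
      (TensorProduct.assoc k V W U).toLinearMap := by
  refine .of_tmul fun h x u => ?_
  induction x with
  | zero => simp
  | add x y hx hy => simp only [TensorProduct.add_tmul, map_add, hx, hy]
  | tmul v w =>
    simp [ampRep_apply, tensorRep_tmul _ _ (ℛ k h), TensorProduct.sum_tmul]

/-- `h ⊗ w ↦ ∑ h₁ ⊗ f(h₂) w`. -/
noncomputable def rightTwist (f : H →ₗ[k] Module.End k W) : H ⊗[k] W →ₗ[k] H ⊗[k] W :=
  (TensorProduct.lift f).lTensor H ∘ₗ (TensorProduct.assoc k H H W).toLinearMap ∘ₗ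
    (comul (R := k) (A := H)).rTensor W

lemma rightTwist_tmul (f : H →ₗ[k] Module.End k W) {ι : Type*} {h : H} (r : Coalgebra.Repr k h ι)
    (w : W) : rightTwist f (h ⊗ₜ w) = ∑ i ∈ r.index, r.left i ⊗ₜ f (r.right i) w := by
  simp [rightTwist, ← r.eq, TensorProduct.sum_tmul]

/-- `v ⊗ h ↦ ∑ f(h₁) v ⊗ h₂`. -/
noncomputable def leftTwist (f : H →ₗ[k] Module.End k V) : V ⊗[k] H →ₗ[k] V ⊗[k] H :=
  (TensorProduct.lift f.flip).rTensor H ∘ₗ (TensorProduct.assoc k V H H).symm.toLinearMap ∘ₗ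
    (comul (R := k) (A := H)).lTensor V

lemma leftTwist_tmul (f : H →ₗ[k] Module.End k V) {ι : Type*} {h : H} (r : Coalgebra.Repr k h ι)
    (v : V) : leftTwist f (v ⊗ₜ h) = ∑ i ∈ r.index, f (r.left i) v ⊗ₜ r.right i := by
  simp [leftTwist, ← r.eq, TensorProduct.tmul_sum]

lemma rightTwist_comp_rightTwist {f g : H →ₗ[k] Module.End k W}
    (hfg : ∀ h, ∑ i ∈ (ℛ k h).index, f ((ℛ k h).left i) * g ((ℛ k h).right i) =
      counit (R := k) h • 1) : rightTwist f ∘ₗ rightTwist g = .id := by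
  ext h w
  let T : H →ₗ[k] H →ₗ[k] H →ₗ[k] H ⊗[k] W :=
    LinearMap.mk₂ k (fun a b => TensorProduct.mk k H W a ∘ₗ f b ∘ₗ g.flip w)
      (by intros; ext; simp)
      (by intros; ext; simp [TensorProduct.smul_tmul'])
      (by intros; ext; simp [TensorProduct.tmul_add])
      (by intros; ext; simp)
  have key := sum_trilinear_comul_eq T h
  have h1 : ∀ i, ∑ j ∈ (ℛ k ((ℛ k h).right i)).index, T ((ℛ k h).left i)
      ((ℛ k ((ℛ k h).right i)).left j) ((ℛ k ((ℛ k h).right i)).right j) =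
      counit (R := k) ((ℛ k h).right i) • ((ℛ k h).left i ⊗ₜ w) := by
    intro i
    have := congrArg (fun φ : Module.End k W => (ℛ k h).left i ⊗ₜ[k] φ w) (hfg ((ℛ k h).right i))
    simpa [T, TensorProduct.tmul_sum] using this
  rw [Finset.sum_congr rfl fun i _ => h1 i] at key
  have h2 := sum_smul_counit ((TensorProduct.mk k H W).flip w) h
  simp only [LinearMap.flip_apply, TensorProduct.mk_apply] at h2
  rw [h2] at key
  simp only [TensorProduct.AlgebraTensorModule.curry_apply, LinearMap.restrictScalars_self,
    TensorProduct.curry_apply, LinearMap.comp_apply, LinearMap.id_apply]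
  rw [rightTwist_tmul g (ℛ k h), map_sum]
  simp_rw [rightTwist_tmul f (ℛ k ((ℛ k h).left _))]
  exact key

lemma leftTwist_comp_leftTwist {f g : H →ₗ[k] Module.End k V}
    (hfg : ∀ h, ∑ i ∈ (ℛ k h).index, f ((ℛ k h).right i) * g ((ℛ k h).left i) =
      counit (R := k) h • 1) : leftTwist f ∘ₗ leftTwist g = .id := by
  ext v h
  let T : H →ₗ[k] H →ₗ[k] H →ₗ[k] V ⊗[k] H :=
    LinearMap.mk₂ k (fun a b => TensorProduct.mk k V H (f b (g a v)))
      (by intros; ext; simp)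
      (by intros; ext; simp [TensorProduct.smul_tmul'])
      (by intros; ext; simp)
      (by intros; ext; simp [TensorProduct.smul_tmul'])
  have key := sum_trilinear_comul_eq T h
  have h1 : ∀ i, ∑ j ∈ (ℛ k ((ℛ k h).left i)).index, T
      ((ℛ k ((ℛ k h).left i)).left j) ((ℛ k ((ℛ k h).left i)).right j) ((ℛ k h).right i) =
      v ⊗ₜ (counit (R := k) ((ℛ k h).left i) • (ℛ k h).right i) := by
    intro i
    have := congrArg (fun φ : Module.End k V => φ v ⊗ₜ[k] (ℛ k h).right i) (hfg ((ℛ k h).left i))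
    simpa [T, TensorProduct.sum_tmul, TensorProduct.smul_tmul'] using this
  rw [Finset.sum_congr rfl fun i _ => h1 i, ← TensorProduct.tmul_sum, sum_counit_smul] at key
  simp only [TensorProduct.AlgebraTensorModule.curry_apply, LinearMap.restrictScalars_self,
    TensorProduct.curry_apply, LinearMap.comp_apply, LinearMap.id_apply]
  rw [leftTwist_tmul g (ℛ k h), map_sum]
  simp_rw [leftTwist_tmul f (ℛ k ((ℛ k h).right _))]
  exact key.symm

/-- The untwisting isomorphism `H ⊗ W ≃ H ⊗ W`, `h ⊗ w ↦ ∑ h₁ ⊗ h₂ w`. -/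
noncomputable def untwist (ρ : H →ₐ[k] Module.End k W) : (H ⊗[k] W) ≃ₗ[k] (H ⊗[k] W) :=
  .ofLinearMap (rightTwist ρ.toLinearMap) (rightTwist (ρ.toLinearMap ∘ₗ antipode k))
    (rightTwist_comp_rightTwist fun h => by
      simpa using congrArg ρ (sum_mul_antipode_eq_smul (ℛ k h)))
    (rightTwist_comp_rightTwist fun h => by
      simpa using congrArg ρ (sum_antipode_mul_eq_smul (ℛ k h)))

lemma intertwines_untwist (ρ : H →ₐ[k] Module.End k W) :
    Intertwines (ampRep (Algebra.lmul k H) W) (tensorRep (Algebra.lmul k H) ρ)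
      (untwist ρ).toLinearMap := by
  refine .of_tmul fun b h w => ?_
  change rightTwist ρ.toLinearMap (ampRep (Algebra.lmul k H) W b (h ⊗ₜ w)) =
    tensorRep (Algebra.lmul k H) ρ b (rightTwist ρ.toLinearMap (h ⊗ₜ w))
  rw [rightTwist_tmul _ (ℛ k h), map_sum]
  simp_rw [tensorRep_tmul _ _ (ℛ k b)]
  rw [ampRep_apply, LinearMap.rTensor_tmul, Finset.sum_comm]
  refine (rightTwist_tmul _ ((ℛ k b).mul (ℛ k h)) w).trans ?_
  simp [Finset.sum_product]

lemma intertwines_comul : Intertwines (Algebra.lmul k H)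
    (tensorRep (Algebra.lmul k H) (Algebra.lmul k H)) (comul (R := k) (A := H)) := fun b x => by
  have h1 : ∀ y, tensorRep (Algebra.lmul k H) (Algebra.lmul k H) b y = comul (R := k) b * y := by
    intro y
    induction y with
    | zero => simp
    | add y z hy hz => rw [map_add, hy, hz, mul_add]
    | tmul v w => simp [tensorRep_tmul _ _ (ℛ k b), ← (ℛ k b).eq, Finset.sum_mul]
  rw [h1]
  exact Bialgebra.comul_mul b x

lemma intertwines_leftTwist (ρ : H →ₐ[k] Module.End k V) :
    Intertwines (ampRep (Algebra.lmul k H) V) (tensorRep ρ (Algebra.lmul k H))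
      (leftTwist ρ.toLinearMap ∘ₗ (TensorProduct.comm k H V).toLinearMap) := by
  refine .of_tmul fun b h v => ?_
  simp only [ampRep_apply, LinearMap.rTensor_tmul, LinearMap.comp_apply, LinearEquiv.coe_coe,
    TensorProduct.comm_tmul]
  rw [leftTwist_tmul _ (ℛ k h), map_sum]
  simp_rw [tensorRep_tmul _ _ (ℛ k b)]
  rw [Finset.sum_comm]
  refine (leftTwist_tmul _ ((ℛ k b).mul (ℛ k h)) v).trans ?_
  simp [Finset.sum_product]

lemma leftTwist_surjective [FiniteDimensional k H] (ρ : H →ₐ[k] Module.End k V) :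
    Function.Surjective (leftTwist ρ.toLinearMap) := by
  let S := LinearEquiv.ofBijective (antipode k : H →ₗ[k] H) (antipode_bijective k H)
  have hS : ∀ x, antipode k (S.symm x) = x := S.apply_symm_apply
  have := leftTwist_comp_leftTwist (f := ρ.toLinearMap) (g := ρ.toLinearMap ∘ₗ S.symm.toLinearMap)
    fun h => by
      have h1 : ∑ i ∈ (ℛ k h).index, (ℛ k h).right i * S.symm ((ℛ k h).left i) =
          counit (R := k) h • 1 := by
        apply S.injective
        change antipode k _ = antipode k _
        simp [antipode_mul_antidistrib, hS, sum_mul_antipode_eq_smul, antipode_one]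
      simpa using congrArg ρ h1
  exact fun x => ⟨_, LinearMap.congr_fun this x⟩

end Representations

section StableFamilies

variable {k H V W V' U : Type u} [Field k] [Ring H] [HopfAlgebra k H]
  [AddCommGroup V] [Module k V] [AddCommGroup W] [Module k W]
  [AddCommGroup V'] [Module k V'] [AddCommGroup U] [Module k U]

/-- The span of the vectors `h v - ε(h) v`. -/
def augSub (ρ : H →ₐ[k] Module.End k V) : Submodule k V :=
  Submodule.span k {x | ∃ h v, x = ρ h v - counit (R := k) h • v}

lemma sub_mem_augSub (ρ : H →ₐ[k] Module.End k V) (h : H) (v : V) :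
    ρ h v - counit (R := k) h • v ∈ augSub ρ := Submodule.subset_span ⟨h, v, rfl⟩

lemma map_mem_augSub {ρ : H →ₐ[k] Module.End k V} {σ : H →ₐ[k] Module.End k W} {f : V →ₗ[k] W}
    (hf : Intertwines ρ σ f) {v : V} (hv : v ∈ augSub ρ) : f v ∈ augSub σ := by
  suffices augSub ρ ≤ (augSub σ).comap f from this hv
  refine Submodule.span_le.2 ?_
  rintro _ ⟨h, v, rfl⟩
  simpa [hf h v] using sub_mem_augSub σ h (f v)

lemma augSub_le_map {ρ : H →ₐ[k] Module.End k V} {σ : H →ₐ[k] Module.End k W} {f : V →ₗ[k] W}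
    (hf : Intertwines ρ σ f) (hs : Function.Surjective f) : augSub σ ≤ (augSub ρ).map f := by
  refine Submodule.span_le.2 ?_
  rintro _ ⟨h, w, rfl⟩
  obtain ⟨v, rfl⟩ := hs w
  exact ⟨_, sub_mem_augSub ρ h v, by simp [hf h v]⟩

lemma apply_eq_zero_of_mem_augSub {Λ : H} (hΛ : ∀ h, Λ * h = counit (R := k) h • Λ)
    {ρ : H →ₐ[k] Module.End k V} {v : V} (hv : v ∈ augSub ρ) : ρ Λ v = 0 := by
  suffices augSub ρ ≤ LinearMap.ker (ρ Λ) from this hv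
  refine Submodule.span_le.2 ?_
  rintro _ ⟨h, v, rfl⟩
  have : ρ Λ (ρ h v) = counit (R := k) h • ρ Λ v := by
    rw [← Module.End.mul_apply, ← map_mul, hΛ, map_smul, LinearMap.smul_apply]
  simp [this]

/-- Every vector killed by `Λ` lies in `augSub ρ`. -/
def IsAug (Λ : H) (ρ : H →ₐ[k] Module.End k V) : Prop := ∀ v, ρ Λ v = 0 → v ∈ augSub ρ

lemma IsAug.of_bijective {Λ : H} {ρ : H →ₐ[k] Module.End k V} {σ : H →ₐ[k] Module.End k W}
    {f : V →ₗ[k] W} (h : IsAug Λ ρ) (hf : Intertwines ρ σ f) (hb : Function.Bijective f) :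
    IsAug Λ σ := fun w hw => by
  obtain ⟨v, rfl⟩ := hb.2 w
  exact map_mem_augSub hf (h v (hb.1 (by rw [hf, hw, map_zero])))

lemma isAug_lmul {Λ : H} (h0 : Λ ≠ 0) (hΛ : ∀ h, Λ * h = counit (R := k) h • Λ) :
    IsAug Λ (Algebra.lmul k H) := fun m hm => by
  have : counit (R := k) m = 0 := by
    have h1 : Λ * m = 0 := hm
    rw [hΛ] at h1
    exact (smul_eq_zero.1 h1).resolve_right h0
  simpa [this] using sub_mem_augSub (Algebra.lmul k H) m 1

lemma IsAug.ampRep {Λ : H} {ρ : H →ₐ[k] Module.End k V} (h : IsAug Λ ρ) :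
    IsAug Λ (ampRep ρ W) := fun x hx => by
  have hW := Module.Free.chooseBasis k W
  obtain ⟨b, rfl⟩ := TensorProduct.eq_repr_basis_right hW x
  rw [map_finsuppSum] at hx
  have hb : ∀ i, ρ Λ (b i) = 0 := by
    have h1 := TensorProduct.sum_tmul_basis_right_eq_zero hW (b.mapRange (ρ Λ) (map_zero _)) (by
      rw [Finsupp.sum_mapRange_index (by simp)]
      simpa [ampRep_apply] using hx)
    exact fun i => DFunLike.congr_fun h1 i
  refine Submodule.sum_mem _ fun i _ => ?_
  have hi : Intertwines ρ (_root_.ampRep ρ W) ((TensorProduct.mk k V W).flip (hW i)) :=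
    fun h v => by simp [ampRep_apply]
  exact map_mem_augSub hi (h _ (hb i))

/-- There are `n` vectors killed by `Λ` that are linearly independent modulo `augSub ρ`. -/
def HasStable (Λ : H) (ρ : H →ₐ[k] Module.End k V) (n : ℕ) : Prop :=
  ∃ m : Fin n → V, (∀ i, ρ Λ (m i) = 0) ∧ LinearIndependent k fun i => (augSub ρ).mkQ (m i)

lemma HasStable.le_finrank [FiniteDimensional k V] {Λ : H} {ρ : H →ₐ[k] Module.End k V} {n : ℕ}
    (h : HasStable Λ ρ n) : n ≤ Module.finrank k V := by
  obtain ⟨m, -, hm⟩ := h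
  simpa using (LinearIndependent.of_comp (augSub ρ).mkQ hm).fintype_card_le_finrank

lemma HasStable.of_surjective {Λ : H} (hΛ : ∀ h, Λ * h = counit (R := k) h • Λ)
    {ρ : H →ₐ[k] Module.End k V} {σ : H →ₐ[k] Module.End k W}
    {f : V →ₗ[k] W} {n : ℕ} (h : HasStable Λ ρ n) (hf : Intertwines ρ σ f)
    (hs : Function.Surjective f) (hk : ∀ l, f l = 0 → ρ Λ l = 0 → l ∈ augSub ρ) :
    HasStable Λ σ n := by
  obtain ⟨m, hm, hli⟩ := h
  refine ⟨fun i => f (m i), fun i => by rw [← hf, hm, map_zero], ?_⟩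
  rw [Fintype.linearIndependent_iff] at hli ⊢
  intro c hc
  refine hli c ?_
  simp_rw [← map_smul, ← map_sum, Submodule.mkQ_apply, Submodule.Quotient.mk_eq_zero] at hc ⊢
  obtain ⟨v, hv, hfv⟩ := augSub_le_map hf hs hc
  rw [← sub_add_cancel (∑ i, c i • m i) v]
  refine add_mem (hk _ (by rw [map_sub, hfv, sub_self]) ?_) hv
  rw [map_sub, apply_eq_zero_of_mem_augSub hΛ hv]
  simp [hm]

lemma HasStable.of_bijective {Λ : H} (hΛ : ∀ h, Λ * h = counit (R := k) h • Λ)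
    {ρ : H →ₐ[k] Module.End k V} {σ : H →ₐ[k] Module.End k W}
    {f : V →ₗ[k] W} {n : ℕ} (h : HasStable Λ ρ n) (hf : Intertwines ρ σ f)
    (hb : Function.Bijective f) : HasStable Λ σ n :=
  h.of_surjective hΛ hf hb.2 fun l hl _ => by
    rw [(map_eq_zero_iff f hb.1).1 hl]; exact zero_mem _

lemma HasStable.ampRep [FiniteDimensional k W] {Λ : H} {ρ : H →ₐ[k] Module.End k V} {n : ℕ}
    (h : HasStable Λ ρ n) : HasStable Λ (ampRep ρ W) (n * Module.finrank k W) := by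
  obtain ⟨m, hm, hli⟩ := h
  let b := Module.finBasis k W
  refine ⟨fun i => m (finProdFinEquiv.symm i).1 ⊗ₜ b (finProdFinEquiv.symm i).2,
    fun i => by simp [ampRep_apply, hm], ?_⟩
  have h1 := hli.tmul_of_flat_left b.linearIndependent
  let q : (V ⊗[k] W ⧸ augSub (_root_.ampRep ρ W)) →ₗ[k] (V ⧸ augSub ρ) ⊗[k] W :=
    (augSub (_root_.ampRep ρ W)).liftQ ((augSub ρ).mkQ.rTensor W) <| Submodule.span_le.2 <| by
      rintro _ ⟨h, x, rfl⟩
      simp only [SetLike.mem_coe, LinearMap.mem_ker]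
      induction x with
      | zero => simp
      | add x y hx hy =>
        rw [map_add, smul_add, add_sub_add_comm, map_add, hx, hy, add_zero]
      | tmul v w =>
        have : (augSub ρ).mkQ (ρ h v - counit (R := k) h • v) = 0 :=
          (Submodule.Quotient.mk_eq_zero _).2 (sub_mem_augSub ρ h v)
        rw [ampRep_apply, LinearMap.rTensor_tmul, TensorProduct.smul_tmul',
          ← TensorProduct.sub_tmul, LinearMap.rTensor_tmul, this, TensorProduct.zero_tmul]
  refine LinearIndependent.of_comp q ?_
  exact h1.comp _ finProdFinEquiv.symm.injective

end StableFamilies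

namespace HopfInclusion

variable {k H D V W : Type u} [Field k] [Ring H] [HopfAlgebra k H] [Ring D] [HopfAlgebra k D]
  [AddCommGroup V] [Module k V] [AddCommGroup W] [Module k W] (incl : HopfInclusion k H D)

/-- The left multiplication of `H` on `D`. -/
noncomputable def leftRep : H →ₐ[k] Module.End k D := (Algebra.lmul k D).comp incl.ι

lemma leftRep_apply (h : H) (d : D) : incl.leftRep h d = incl.ι h * d := rfl

lemma tensorRep_comp (α : D →ₐ[k] Module.End k V) (β : D →ₐ[k] Module.End k W) :
    tensorRep (α.comp incl.ι) (β.comp incl.ι) = (tensorRep α β).comp incl.ι := by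
  refine AlgHom.ext fun h => ?_
  have h1 : Algebra.TensorProduct.map (α.comp incl.ι) (β.comp incl.ι) (comul (R := k) h) =
      Algebra.TensorProduct.map α β (comul (R := k) (incl.ι h)) := by
    rw [incl.compat_comul, Algebra.TensorProduct.map_comp]
    rfl
  exact congrArg (Module.endTensorEndAlgHom (R := k) (S := k) (A := k)) h1

lemma intertwines_comp {α : D →ₐ[k] Module.End k V} {β : D →ₐ[k] Module.End k W} {f : V →ₗ[k] W}
    (hf : Intertwines α β f) : Intertwines (α.comp incl.ι) (β.comp incl.ι) f :=
  fun h v => hf (incl.ι h) v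

lemma intertwines_untwist_leftRep :
    Intertwines (ampRep incl.leftRep D) (tensorRep incl.leftRep incl.leftRep)
      (untwist (Algebra.lmul k D)).toLinearMap := by
  rw [leftRep, tensorRep_comp]
  exact incl.intertwines_comp (intertwines_untwist (Algebra.lmul k D))

/-- The quotient of `D` by the image of `H`. -/
abbrev Quot : Type u := D ⧸ LinearMap.range incl.ι.toLinearMap

/-- The left multiplication of `H` on `D / H`. -/
noncomputable def quotRep : H →ₐ[k] Module.End k incl.Quot :=
  AlgHom.ofLinearMap
    { toFun := fun h => (LinearMap.range incl.ι.toLinearMap).mapQ _ (incl.leftRep h) <| by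
        rintro _ ⟨x, rfl⟩
        exact ⟨h * x, by simp [leftRep_apply]⟩
      map_add' := fun a b => by ext; simp
      map_smul' := fun a b => by ext; simp }
    (by ext; simp) (fun a b => by ext; simp)

lemma intertwines_mkQ : Intertwines incl.leftRep incl.quotRep
    (LinearMap.range incl.ι.toLinearMap).mkQ := fun _ _ => rfl

lemma intertwines_ι : Intertwines (Algebra.lmul k H) incl.leftRep incl.ι.toLinearMap :=
  fun h x => map_mul incl.ι h x

lemma isAug_tensorRep_tensorRep [FiniteDimensional k H] [FiniteDimensional k V] {Λ : H}
    (h0 : Λ ≠ 0) (hΛ : ∀ h, Λ * h = counit (R := k) h • Λ) (ρ : H →ₐ[k] Module.End k V) :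
    IsAug Λ (tensorRep ρ (tensorRep (Algebra.lmul k H) incl.leftRep)) := by
  have h1 : IsAug Λ (tensorRep ρ (Algebra.lmul k H)) :=
    (isAug_lmul h0 hΛ).ampRep.of_bijective (intertwines_leftTwist ρ) <|
      Function.Bijective.comp (g := leftTwist ρ.toLinearMap)
        ⟨LinearMap.injective_iff_surjective.2 (leftTwist_surjective ρ), leftTwist_surjective ρ⟩
        (TensorProduct.comm k H V).bijective
  have h2 : IsAug Λ (tensorRep ρ (ampRep (Algebra.lmul k H) D)) :=
    h1.ampRep.of_bijective (intertwines_assoc_ampRep _ _) (TensorProduct.assoc k V H D).bijective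
  exact h2.of_bijective ((intertwines_id ρ).map (intertwines_untwist incl.leftRep))
    (TensorProduct.congr (.refl k V) (untwist incl.leftRep)).bijective

lemma hasStable_step [FiniteDimensional k H] [FiniteDimensional k D] [FiniteDimensional k V]
    {Λ : H} (h0 : Λ ≠ 0) (hΛ : ∀ h, Λ * h = counit (R := k) h • Λ)
    {ρ : H →ₐ[k] Module.End k V} {n : ℕ} (h : HasStable Λ (tensorRep ρ incl.leftRep) n) :
    HasStable Λ (tensorRep (tensorRep ρ incl.quotRep) incl.leftRep)
      (n * Module.finrank k D) := by
  have h1 : HasStable Λ (tensorRep ρ (ampRep incl.leftRep D)) (n * Module.finrank k D) :=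
    h.ampRep.of_bijective hΛ (intertwines_assoc_ampRep _ _) (TensorProduct.assoc k V D D).bijective
  have h2 := h1.of_bijective hΛ ((intertwines_id ρ).map incl.intertwines_untwist_leftRep)
    (TensorProduct.congr (.refl k V) (untwist (Algebra.lmul k D))).bijective
  set j := incl.ι.toLinearMap with hj
  set π := (LinearMap.range j).mkQ with hπ
  have hjπ : Function.Exact j π := LinearMap.exact_map_mkQ_range j
  have hπs : Function.Surjective π := Submodule.mkQ_surjective _
  have hex : Function.Exact ((j.rTensor D).lTensor V) ((π.rTensor D).lTensor V) :=
    lTensor_exact V (rTensor_exact D hjπ hπs) (LinearMap.rTensor_surjective D hπs)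
  have hinj : Function.Injective ((j.rTensor D).lTensor V) :=
    Module.Flat.lTensor_preserves_injective_linearMap _
      (Module.Flat.rTensor_preserves_injective_linearMap _ incl.inj)
  have hj' : Intertwines (tensorRep ρ (tensorRep (Algebra.lmul k H) incl.leftRep))
      (tensorRep ρ (tensorRep incl.leftRep incl.leftRep)) ((j.rTensor D).lTensor V) :=
    (intertwines_id ρ).map (incl.intertwines_ι.map (intertwines_id _))
  have h3 : HasStable Λ (tensorRep ρ (tensorRep incl.quotRep incl.leftRep))
      (n * Module.finrank k D) :=
    h2.of_surjective hΛ (f := (π.rTensor D).lTensor V)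
      ((intertwines_id ρ).map (incl.intertwines_mkQ.map (intertwines_id _)))
      (LinearMap.lTensor_surjective V (LinearMap.rTensor_surjective D hπs)) fun l hl hΛl => by
        obtain ⟨y, rfl⟩ := (hex l).1 hl
        refine map_mem_augSub hj' (incl.isAug_tensorRep_tensorRep h0 hΛ ρ y (hinj ?_))
        rw [hj', hΛl, map_zero]
  exact h3.of_bijective hΛ (intertwines_assoc _ _ _).symm
    (TensorProduct.assoc k V incl.Quot D).symm.bijective

lemma exists_hasStable [FiniteDimensional k H] [FiniteDimensional k D]
    {Λ : H} (h0 : Λ ≠ 0) (hΛ : ∀ h, Λ * h = counit (R := k) h • Λ)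
    {x : D} (hx : incl.ι Λ * x = 0) (hεx : counit (R := k) x ≠ 0) (m : ℕ) :
    ∃ (V : Type u) (_ : AddCommGroup V) (_ : Module k V) (_ : FiniteDimensional k V)
      (ρ : H →ₐ[k] Module.End k V), Module.finrank k V = Module.finrank k incl.Quot ^ m ∧
        HasStable Λ (tensorRep ρ incl.leftRep) (Module.finrank k D ^ m) := by
  induction m with
  | zero =>
    refine ⟨k, inferInstance, inferInstance, inferInstance,
      (Algebra.lmul k k).comp (Bialgebra.counitAlgHom k H), by simp, ?_⟩
    have hx' : x ∉ augSub incl.leftRep := fun hmem => by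
      suffices augSub incl.leftRep ≤ LinearMap.ker (counit (R := k) (A := D)) from
        hεx (this hmem)
      refine Submodule.span_le.2 ?_
      rintro _ ⟨h, v, rfl⟩
      simp [leftRep_apply, incl.compat_counit]
    have h1 : HasStable Λ incl.leftRep (Module.finrank k D ^ 0) :=
      ⟨fun _ => x, fun _ => hx, by
        rw [pow_zero, linearIndependent_unique_iff]
        simpa using hx'⟩
    refine h1.of_bijective hΛ (f := (TensorProduct.lid k D).symm.toLinearMap) (fun h d => ?_)
      (TensorProduct.lid k D).symm.bijective
    simp only [LinearEquiv.coe_coe, TensorProduct.lid_symm_apply]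
    rw [tensorRep_tmul _ _ (ℛ k h)]
    conv_lhs => rw [← sum_counit_smul (R := k) (ℛ k h)]
    simp [TensorProduct.tmul_sum, TensorProduct.smul_tmul']
  | succ m ih =>
    obtain ⟨V, _, _, _, ρ, hV, hs⟩ := ih
    refine ⟨V ⊗[k] incl.Quot, inferInstance, inferInstance, inferInstance,
      tensorRep ρ incl.quotRep, by rw [Module.finrank_tensorProduct, hV, pow_succ], ?_⟩
    rw [pow_succ]
    exact incl.hasStable_step h0 hΛ hs

lemma finrank_quot_lt [FiniteDimensional k D] {Λ : H} (h0 : Λ ≠ 0) :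
    Module.finrank k incl.Quot < Module.finrank k D := by
  have h1 : Module.finrank k incl.Quot + Module.finrank k (LinearMap.range incl.ι.toLinearMap) =
      Module.finrank k D := Submodule.finrank_quotient_add_finrank _
  have h2 : 0 < Module.finrank k (LinearMap.range incl.ι.toLinearMap) :=
    Module.finrank_pos_iff_exists_ne_zero.2 ⟨⟨incl.ι Λ, Λ, rfl⟩, fun h =>
      h0 (incl.inj ((congrArg Subtype.val h).trans (map_zero incl.ι).symm))⟩
  omega

/-- A vector of `D` that is killed by a right integral of `H` is killed by the counit. -/
lemma counit_eq_zero_of_integral_mul [FiniteDimensional k H] [FiniteDimensional k D]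
    {Λ : H} (h0 : Λ ≠ 0) (hΛ : ∀ h, Λ * h = counit (R := k) h • Λ)
    {x : D} (hx : incl.ι Λ * x = 0) : counit (R := k) x = 0 := by
  by_contra hεx
  set n := Module.finrank k D
  set q := Module.finrank k incl.Quot
  have hqn : q < n := incl.finrank_quot_lt h0
  have hle : ∀ m : ℕ, n ^ m ≤ q ^ m * n := fun m => by
    obtain ⟨V, _, _, _, ρ, hV, hs⟩ := incl.exists_hasStable h0 hΛ hx hεx m
    simpa [Module.finrank_tensorProduct, hV] using hs.le_finrank
  have hn : (0 : ℝ) < n := by exact_mod_cast (Nat.zero_le q).trans_lt hqn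
  obtain ⟨m, hm⟩ := exists_pow_lt_of_lt_one (inv_pos.2 hn)
    ((div_lt_one hn).2 (by exact_mod_cast hqn : (q : ℝ) < n))
  have h1 : (n : ℝ) ^ m ≤ q ^ m * n := by exact_mod_cast hle m
  rw [div_pow, div_lt_iff₀ (by positivity), inv_mul_eq_div, lt_div_iff₀ hn] at hm
  exact absurd h1 (not_le.2 hm)

end HopfInclusion

section Projective

variable {k H D : Type u} [Field k] [Ring H] [HopfAlgebra k H] [Ring D] [HopfAlgebra k D]
  (incl : HopfInclusion k H D)

namespace HopfInclusion

/-- A Sweedler representation of `ι h` obtained from one of `h`. -/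
noncomputable def repr {ι : Type*} {h : H} (r : Coalgebra.Repr k h ι) :
    Coalgebra.Repr k (incl.ι h) ι where
  index := r.index
  left i := incl.ι (r.left i)
  right i := incl.ι (r.right i)
  eq := by rw [incl.compat_comul, ← r.eq]; simp

/-- There is an `H`-linear map `D → H` that is compatible with the counits. -/
lemma exists_intertwines_counit [FiniteDimensional k H] [FiniteDimensional k D] :
    ∃ γ : D →ₗ[k] H, Intertwines incl.leftRep (Algebra.lmul k H) γ ∧
      ∀ d, counit (R := k) (γ d) = counit (R := k) d := by
  obtain ⟨Λ, hl, h0, hr⟩ := exists_antipode_isRightIntegral k H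
  obtain ⟨φ, hφ⟩ : ∃ φ : D →ₗ[k] k, φ ∘ₗ incl.leftRep (antipode k Λ) = counit := by
    have : counit (R := k) (A := D) ∈ LinearMap.range (incl.leftRep (antipode k Λ)).dualMap := by
      rw [LinearMap.range_dualMap_eq_dualAnnihilator_ker, Submodule.mem_dualAnnihilator]
      exact fun x hx => incl.counit_eq_zero_of_integral_mul h0 hr hx
    exact this
  refine ⟨hopfAverage incl.leftRep (Algebra.lmul k H) (φ.smulRight 1) Λ, fun h d =>
    hopfAverage_intertwines _ _ _ (fun z => by rw [hl, map_smul]) h d, fun d => ?_⟩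
  rw [hopfAverage_eq_sum _ _ _ (ℛ k Λ)]
  have h1 : ∑ i ∈ (ℛ k Λ).index, counit (R := k) ((ℛ k Λ).left i) • (ℛ k Λ).right i = Λ :=
    sum_counit_smul (ℛ k Λ)
  have h2 := LinearMap.congr_fun hφ d
  rw [← h1] at h2
  simpa [mul_comm] using h2

/-- `D` is projective as an `H`-module. -/
lemma projective [FiniteDimensional k H] [FiniteDimensional k D] :
    letI : Module H D := Module.compHom D incl.ι.toRingHom
    Module.Projective H D := by
  let _ : Module H D := Module.compHom D incl.ι.toRingHom
  obtain ⟨γ, hγ, hε⟩ := incl.exists_intertwines_counit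
  have hcomul : Intertwines incl.leftRep (tensorRep incl.leftRep incl.leftRep)
      (comul (R := k) (A := D)) := by
    rw [leftRep, tensorRep_comp]
    exact incl.intertwines_comp intertwines_comul
  let u := untwist incl.leftRep
  let s := u.symm.toLinearMap ∘ₗ γ.rTensor D ∘ₗ comul (R := k) (A := D)
  have hs : ∀ h d, s (incl.leftRep h d) = ampRep (Algebra.lmul k H) D h (s d) := fun h d => by
    have h1 := (intertwines_untwist incl.leftRep).symm h (γ.rTensor D (comul (R := k) d))
    have h2 := (hγ.map (intertwines_id incl.leftRep)) h (comul (R := k) d)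
    rw [← hcomul h] at h2
    exact (congrArg u.symm h2).trans h1
  let r := (TensorProduct.lid k D).toLinearMap ∘ₗ (counit (R := k) (A := H)).rTensor D ∘ₗ
    u.toLinearMap
  have hr : ∀ h d, r (h ⊗ₜ d) = incl.ι h * d := fun h d => by
    have h1 : u (h ⊗ₜ d) = _ := rightTwist_tmul _ (ℛ k h) d
    have h2 := congrArg (fun x => incl.ι x * d) (sum_counit_smul (R := k) (ℛ k h))
    simp only [map_sum, map_smul, Finset.sum_mul, smul_mul_assoc] at h2
    simpa [r, h1, leftRep_apply] using h2
  have hrs : ∀ d, r (s d) = d := fun d => by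
    have h1 : counit (R := k) (A := H) ∘ₗ γ = counit := LinearMap.ext hε
    simp only [r, s, LinearMap.comp_apply, LinearEquiv.coe_coe, LinearEquiv.apply_symm_apply]
    rw [← LinearMap.comp_apply (LinearMap.rTensor D counit), ← LinearMap.rTensor_comp, h1,
      rTensor_counit_comul]
    simp
  let i : D →ₗ[H] H ⊗[k] D := { s with map_smul' := fun h d => hs h d }
  let p : H ⊗[k] D →ₗ[H] D :=
    { r with
      map_smul' := fun h x => by
        change r (h • x) = incl.ι h * r x
        induction x with
        | zero => simp
        | add x y hx hy => rw [smul_add, map_add, hx, hy, map_add, mul_add]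
        | tmul a d => rw [TensorProduct.smul_tmul', hr, hr, smul_eq_mul, map_mul, mul_assoc] }
  exact Module.Projective.of_split i p (LinearMap.ext hrs)

/-- A projective `D`-module is projective over `H`. -/
lemma projective_restrict [FiniteDimensional k H] [FiniteDimensional k D] (M : Type u)
    [AddCommGroup M] [Module D M] [Module.Projective D M] :
    letI : Module H M := Module.compHom M incl.ι.toRingHom
    Module.Projective H M := by
  let _ : Module H D := Module.compHom D incl.ι.toRingHom
  let _ : Module H M := Module.compHom M incl.ι.toRingHom
  have : Module.Projective H D := incl.projective
  obtain ⟨s, hs⟩ := Module.projective_def'.1 ‹Module.Projective D M›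
  let i : M →ₗ[H] M →₀ D := { s with map_smul' := fun h m => s.map_smul (incl.ι h) m }
  let p : (M →₀ D) →ₗ[H] M :=
    { Finsupp.linearCombination D id with
      map_smul' := fun h x => (Finsupp.linearCombination D id).map_smul (incl.ι h) x }
  classical
  have : Module.Projective H (M →₀ D) := .of_equiv (finsuppLequivDFinsupp (ι := M) (M := D) H).symm
  exact Module.Projective.of_split i p (LinearMap.ext fun m => LinearMap.congr_fun hs m)

variable {V W : Type u} [AddCommGroup V] [Module k V] [AddCommGroup W] [Module k W]
  {ρ : D →ₐ[k] Module.End k V} {σ : D →ₐ[k] Module.End k W} {g : V →ₗ[k] W}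

lemma hopfAverage_mul_ι (hg : Intertwines (ρ.comp incl.ι) (σ.comp incl.ι) g) (x : D) (h : H) :
    hopfAverage ρ σ g (x * incl.ι h) = counit (R := k) h • hopfAverage ρ σ g x := by
  have h1 : hopfAverage ρ σ g (incl.ι h) = counit (R := k) h • g := by
    rw [hopfAverage_eq_sum _ _ _ (incl.repr (ℛ k h))]
    ext v
    have h2 := congrArg (fun y => g (ρ y v)) (sum_mul_antipode_eq_smul (incl.repr (ℛ k h)))
    simp only [map_sum, map_mul, map_smul, map_one, LinearMap.sum_apply, LinearMap.smul_apply,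
      Module.End.mul_apply, Module.End.one_apply, incl.compat_counit] at h2
    rw [LinearMap.smul_apply, ← h2, LinearMap.sum_apply]
    exact Finset.sum_congr rfl fun i _ => (hg _ _).symm
  rw [hopfAverage_mul, h1, hopfAverage_eq_sum _ _ _ (ℛ k x), hopfAverage_eq_sum _ _ _ (ℛ k x),
    Finset.smul_sum]
  exact Finset.sum_congr rfl fun i _ => by ext; simp

/-- The left ideal of `D` generated by the augmentation ideal of `H`. -/
abbrev augIdeal : Submodule D D := Submodule.span D
  {d : D | ∃ h : H, d = incl.ι h - algebraMap k D (counit (R := k) h)}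

lemma hopfAverage_eq_zero (hg : Intertwines (ρ.comp incl.ι) (σ.comp incl.ι) g) {d : D}
    (hd : d ∈ incl.augIdeal) : hopfAverage ρ σ g d = 0 := by
  induction hd using Submodule.span_induction with
  | mem x hx =>
    obtain ⟨h, rfl⟩ := hx
    have := incl.hopfAverage_mul_ι hg 1 h
    rw [one_mul] at this
    rw [map_sub, this, Algebra.algebraMap_eq_smul_one, map_smul, sub_self]
  | zero => simp
  | add x y _ _ hx hy => rw [map_add, hx, hy, add_zero]
  | smul a x _ hx =>
    rw [smul_eq_mul, hopfAverage_mul, hx, hopfAverage_eq_sum _ _ _ (ℛ k a)]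
    simp

/-- A `D`-module that is projective over `H` is projective. -/
lemma projective_of_restrict {t : D} (ht : counit (R := k) t = 1)
    (htN : ∀ d, d * t - counit (R := k) d • t ∈ incl.augIdeal) (M : Type u)
    [AddCommGroup M] [Module D M]
    (hM : letI : Module H M := Module.compHom M incl.ι.toRingHom
      Module.Projective H M) : Module.Projective D M := by
  let _ : Module H D := Module.compHom D incl.ι.toRingHom
  let _ : Module H M := Module.compHom M incl.ι.toRingHom
  let _ : Module k M := Module.compHom M (algebraMap k D)
  have : IsScalarTower k D M := ⟨fun c d m => by
    rw [Algebra.smul_def, mul_smul]; rfl⟩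
  have hM : Module.Projective H M := hM
  let q := Finsupp.linearCombination D (id : M → M)
  let p : (M →₀ D) →ₗ[H] M := { q with map_smul' := fun h x => q.map_smul (incl.ι h) x }
  have hp : Function.Surjective p := fun m => ⟨.single m 1, by simp [p, q]⟩
  obtain ⟨s, hs⟩ := Module.projective_lifting_property p .id hp
  let g : M →ₗ[k] M →₀ D :=
    { s with
      map_smul' := fun c m => by
        have h1 : s (incl.ι (algebraMap k H c) • m) = incl.ι (algebraMap k H c) • s m :=
          s.map_smul (algebraMap k H c) m
        rw [incl.ι.commutes, algebraMap_smul, algebraMap_smul] at h1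
        exact h1 }
  have hg : Intertwines ((Algebra.lsmul k k M).comp incl.ι)
    ((Algebra.lsmul k k (M →₀ D)).comp incl.ι) g := fun h m => s.map_smul h m
  have hgp : ∀ m, q (g m) = m := fun m => LinearMap.congr_fun hs m
  have hE := hopfAverage_intertwines (Algebra.lsmul k k M) (Algebra.lsmul k k (M →₀ D)) g
    (x := t) fun d => by
      have h1 := incl.hopfAverage_eq_zero hg (htN d)
      rwa [map_sub, map_smul, sub_eq_zero] at h1
  let i : M →ₗ[D] M →₀ D :=
    { hopfAverage (Algebra.lsmul k k M) (Algebra.lsmul k k (M →₀ D)) g t with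
      map_smul' := hE }
  refine Module.Projective.of_split i q (LinearMap.ext fun m => ?_)
  have h1 := congrArg (· • m) (sum_mul_antipode_eq_smul (R := k) (ℛ k t))
  change q (hopfAverage (Algebra.lsmul k k M) (Algebra.lsmul k k (M →₀ D)) g t m) = m
  rw [hopfAverage_eq_sum _ _ _ (ℛ k t)]
  simp only [LinearMap.sum_apply, map_sum, LinearMap.comp_apply, Algebra.lsmul_coe, map_smul, hgp]
  simpa [ht, Finset.sum_smul, mul_smul] using h1

end HopfInclusion

end Projective

end

/-- Lemma `unit-summand-proj`.
Let `H` be a finite-dimensional Hopf algebra (with Drinfeld double `D = D(H)`) such that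
the trivial `D`-module `1_D` is a direct summand of the induced module `D ⊗_H 1_H`
(realized below as the quotient of `D` by the left ideal generated by
`{ι(h) - ε(h)·1 : h ∈ H}`).  Then a `D`-module `M` is projective if and only if its
restriction `F(M)` to `H` is projective. -/
theorem balmer_spectra_drinfeld_centers_statement_15
    (k H D : Type u) [Field k] [Ring H] [HopfAlgebra k H] [Ring D] [HopfAlgebra k D]
    [FiniteDimensional k H] [FiniteDimensional k D]
    (incl : HopfInclusion k H D)
    -- `1_{D}` is a direct summand of `D ⊗_H 1_H` as `D`-modules:
    (hsummand :
      letI N : Submodule D D := Submodule.span D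
        {d : D | ∃ h : H, d = incl.ι h - algebraMap k D (Coalgebra.counit (R := k) h)}
      letI : Module D k := Module.compHom k (Bialgebra.counitAlgHom k D).toRingHom
      ∃ (s : k →ₗ[D] D ⧸ N) (r : (D ⧸ N) →ₗ[D] k), r ∘ₗ s = LinearMap.id) :
    ∀ (M : Type u) [AddCommGroup M] [Module D M],
      Module.Projective D M ↔
        (letI : Module H M := Module.compHom M incl.ι.toRingHom
         Module.Projective H M) := by
  let _ : Module D k := Module.compHom k (Bialgebra.counitAlgHom k D).toRingHom
  obtain ⟨s, r, hsr⟩ := hsummand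
  obtain ⟨x, hx⟩ := Submodule.mkQ_surjective _ (s 1)
  have hsmul : ∀ (d : D) (c : k), d • c = Coalgebra.counit (R := k) d * c := fun _ _ => rfl
  have hr : Coalgebra.counit (R := k) x * r (Submodule.Quotient.mk 1) = 1 := by
    rw [← hsmul, ← map_smul, ← Submodule.Quotient.mk_smul, smul_eq_mul, mul_one]
    exact (congrArg r hx).trans (LinearMap.congr_fun hsr 1)
  have hx0 : Coalgebra.counit (R := k) x ≠ 0 := left_ne_zero_of_mul_eq_one hr
  have hxN : ∀ d : D, d * x - algebraMap k D (Coalgebra.counit (R := k) d) * x ∈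
      incl.augIdeal := fun d => by
    rw [← Submodule.Quotient.mk_eq_zero, Submodule.Quotient.mk_sub, sub_eq_zero]
    have h1 : ∀ a : D, (Submodule.Quotient.mk (a * x) : D ⧸ incl.augIdeal) = s (a • 1) :=
      fun a => by
        rw [map_smul, ← hx]
        rfl
    rw [h1, h1, hsmul, hsmul, Bialgebra.counit_algebraMap]
  intro M _ _
  refine ⟨fun _ => incl.projective_restrict M, incl.projective_of_restrict
    (t := (Coalgebra.counit (R := k) x)⁻¹ • x) (by simp [hx0]) (fun d => ?_) M⟩
  have h1 := incl.augIdeal.smul_mem (algebraMap k D (Coalgebra.counit (R := k) x)⁻¹) (hxN d)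
  rw [smul_sub, smul_eq_mul, smul_eq_mul, ← Algebra.smul_def, ← Algebra.smul_def,
    ← Algebra.smul_def, smul_comm] at h1
  rwa [mul_smul_comm]
end
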